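/- arXiv:2009.03500 — 2 statements merged into one kernel-verified Lean document; each statement's English description precedes it below -/
import Mathlib

section
/- The set 𝓔 ∩ 𝓟 ∩ 𝓐₁ is forward flow-invariant for the Einstein vector field: if c : I → ℝ⁶ is a solution of c'(η) = V(c(η)) on an interval I, η₀, η₁ ∈ I with η₀ ≤ η₁, and c(η₀) ∈ 𝓔 ∩ 𝓟 ∩ 𝓐₁, then c(η₁) ∈ 𝓔 ∩ 𝓟 ∩ 𝓐₁. -/
open Real Set Filter

noncomputable section

/-- The quadratic form `G(p) = X₁² + 2X₂² + 4m X₃²`. -/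
def G (m : ℕ) (p : Fin 6 → ℝ) : ℝ := (p 0)^2 + 2*(p 1)^2 + 4*(m:ℝ)*(p 2)^2

/-- `R₁(p) = (1/2)Y₁²Y₂² + (m/4)Y₁²Y₃²`. -/
def R1 (m : ℕ) (p : Fin 6 → ℝ) : ℝ := (1/2)*(p 3)^2*(p 4)^2 + ((m:ℝ)/4)*(p 3)^2*(p 5)^2

/-- `R₂(p) = 2Y₂² − (1/2)Y₁²Y₂² + (m/2)Y₃²`. -/
def R2 (m : ℕ) (p : Fin 6 → ℝ) : ℝ := 2*(p 4)^2 - (1/2)*(p 3)^2*(p 4)^2 + ((m:ℝ)/2)*(p 5)^2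

/-- `R₃(p) = (m+2)Y₂Y₃ − (1/8)Y₁²Y₃² − (1/2)Y₃²`. -/
def R3 (m : ℕ) (p : Fin 6 → ℝ) : ℝ :=
  ((m:ℝ)+2)*(p 4)*(p 5) - (1/8)*(p 3)^2*(p 5)^2 - (1/2)*(p 5)^2

/-- `R_s = R₁ + 2R₂ + 4m R₃`. -/
def Rs (m : ℕ) (p : Fin 6 → ℝ) : ℝ := R1 m p + 2*R2 m p + 4*(m:ℝ)*R3 m p

/-- `L = (G + R_s − 1)/(4m+2)`. -/
def L (m : ℕ) (p : Fin 6 → ℝ) : ℝ := (G m p + Rs m p - 1)/(4*(m:ℝ)+2)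

/-- The Einstein vector field. -/
def V (m : ℕ) (p : Fin 6 → ℝ) : Fin 6 → ℝ :=
  ![ p 0 * (G m p + L m p - 1) + R1 m p - L m p,
     p 1 * (G m p + L m p - 1) + R2 m p - L m p,
     p 2 * (G m p + L m p - 1) + R3 m p - L m p,
     p 3 * (p 0 - p 1),
     p 4 * (G m p + L m p - p 1),
     p 5 * (G m p + L m p + p 1 - 2*p 2) ]

/-- `𝓔 = {p : X₁+2X₂+4m X₃ = 1 and G + R_s ≤ 1}`. -/
def setE (m : ℕ) : Set (Fin 6 → ℝ) :=
  {p | p 0 + 2*p 1 + 4*(m:ℝ)*p 2 = 1 ∧ G m p + Rs m p ≤ 1}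

/-- `∂𝓔 = {p : X₁+2X₂+4m X₃ = 1 and G + R_s = 1}`. -/
def bdryE (m : ℕ) : Set (Fin 6 → ℝ) :=
  {p | p 0 + 2*p 1 + 4*(m:ℝ)*p 2 = 1 ∧ G m p + Rs m p = 1}

/-- `𝓟 = {p : Y₁ ≥ 0, Y₂ ≥ 0, Y₃ ≥ 0}`. -/
def setP : Set (Fin 6 → ℝ) := {p | 0 ≤ p 3 ∧ 0 ≤ p 4 ∧ 0 ≤ p 5}

/-- `𝓐₁ = {p : X₁ ≤ X₂ and Y₁² ≤ 2}`. -/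
def setA1 : Set (Fin 6 → ℝ) := {p | p 0 ≤ p 1 ∧ (p 3)^2 ≤ 2}

/-- `𝓐₂`. -/
def setA2 : Set (Fin 6 → ℝ) :=
  {p | 0 ≤ 2*p 4 - p 5 ∧ 0 ≤ (Real.sqrt 2/2)*(2*p 4 - p 5) + p 2 - p 1 ∧
       p 1 ≤ 1/2 ∧ 0 ≤ p 2}

/-- The compact invariant set `𝓢`. -/
def setS (m : ℕ) : Set (Fin 6 → ℝ) := setE m ∩ setP ∩ setA1 ∩ setA2

/-- A solution of the Einstein ODE system on a set `I ⊆ ℝ`. -/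
def IsSolution (m : ℕ) (I : Set ℝ) (c : ℝ → Fin 6 → ℝ) : Prop :=
  ∀ η ∈ I, HasDerivWithinAt c (V m (c η)) I η

/-- The squared positive part is differentiable. -/
theorem hasDerivAt_max_zero_sq (x : ℝ) :
    HasDerivAt (fun y : ℝ => (max y 0)^2) (2 * max x 0) x := by
  rcases lt_trichotomy x 0 with hx | rfl | hx
  · rw [max_eq_right hx.le, mul_zero]
    refine (hasDerivAt_const x (0 : ℝ)).congr_of_eventuallyEq ?_
    filter_upwards [Iio_mem_nhds hx] with y hy
    simp [(mem_Iio.1 hy).le]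
  · have h : HasDerivAt (fun y : ℝ => y^2) 0 0 := by simpa using hasDerivAt_pow 2 (0 : ℝ)
    rw [hasDerivAt_iff_isLittleO] at h ⊢
    refine (Asymptotics.IsBigO.of_bound 1 (Eventually.of_forall fun y => ?_)).trans_isLittleO h
    rcases le_total y 0 with hy | hy <;> simp [hy, sq_nonneg]
  · rw [max_eq_left hx.le]
    have h : HasDerivAt (fun y : ℝ => y^2) (2 * x) x := by simpa using hasDerivAt_pow 2 x
    refine h.congr_of_eventuallyEq ?_
    filter_upwards [Ioi_mem_nhds hx] with y hy
    rw [max_eq_left (le_of_lt hy)]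

/-- A cooperative planar linear system preserves the nonpositive quadrant in forward time. -/
theorem nonpos_of_cooperative {s t : ℝ} (hst : s ≤ t) {u w a b d : ℝ → ℝ}
    (hu : ContinuousOn u (Icc s t)) (hw : ContinuousOn w (Icc s t))
    (ha : ContinuousOn a (Icc s t)) (hb : ContinuousOn b (Icc s t))
    (hd : ContinuousOn d (Icc s t))
    (hu' : ∀ x ∈ Ioo s t, HasDerivAt u (a x * u x + b x * w x) x)
    (hw' : ∀ x ∈ Ioo s t, HasDerivAt w (d x * u x) x)
    (hb0 : ∀ x ∈ Ioo s t, 0 ≤ b x) (hd0 : ∀ x ∈ Ioo s t, 0 ≤ d x)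
    (hus : u s ≤ 0) (hws : w s ≤ 0) : u t ≤ 0 ∧ w t ≤ 0 := by
  obtain ⟨A, hA⟩ := isCompact_Icc.exists_bound_of_continuousOn ha
  obtain ⟨B, hB⟩ := isCompact_Icc.exists_bound_of_continuousOn hb
  obtain ⟨D, hD⟩ := isCompact_Icc.exists_bound_of_continuousOn hd
  let φ : ℝ → ℝ := fun x => (max (u x) 0)^2 + (max (w x) 0)^2
  let K : ℝ := 2 * A + B + D
  have hφ0 : φ s = 0 := by simp [φ, hus, hws]
  have hφ' : ∀ x ∈ Ioo s t, HasDerivAt (fun y => φ y * exp (-K * y))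
      ((2 * max (u x) 0 * (a x * u x + b x * w x) + 2 * max (w x) 0 * (d x * u x))
        * exp (-K * x) + φ x * (exp (-K * x) * (-K))) x := by
    intro x hx
    have h1 := (hasDerivAt_max_zero_sq (u x)).comp x (hu' x hx)
    have h2 := (hasDerivAt_max_zero_sq (w x)).comp x (hw' x hx)
    have h3 : HasDerivAt (fun y => exp (-K * y)) (exp (-K * x) * (-K)) x := by
      simpa using ((hasDerivAt_id x).const_mul (-K)).exp
    exact (h1.add h2).mul h3
  have hanti : AntitoneOn (fun y => φ y * exp (-K * y)) (Icc s t) := by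
    refine antitoneOn_of_deriv_nonpos (convex_Icc s t) ?_ ?_ ?_
    · exact (((hu.sup continuousOn_const).pow 2).add ((hw.sup continuousOn_const).pow 2)).mul
        (by fun_prop)
    · rw [interior_Icc]
      exact fun x hx => (hφ' x hx).differentiableAt.differentiableWithinAt
    · rw [interior_Icc]
      intro x hx
      rw [(hφ' x hx).deriv]
      have hxI := Ioo_subset_Icc_self hx
      have hAx := (le_abs_self _).trans (hA x hxI)
      have hBx := (le_abs_self _).trans (hB x hxI)
      have hDx := (le_abs_self _).trans (hD x hxI)
      have hbx := hb0 x hx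
      have hdx := hd0 x hx
      have hpu : max (u x) 0 * u x = max (u x) 0 ^ 2 := by
        rcases le_total (u x) 0 with h | h <;> simp [h, sq]
      have hu0 : 0 ≤ max (u x) 0 := le_max_right _ _
      have hw0 : 0 ≤ max (w x) 0 := le_max_right _ _
      have hule : u x ≤ max (u x) 0 := le_max_left _ _
      have hwle : w x ≤ max (w x) 0 := le_max_left _ _
      have key : 2 * max (u x) 0 * (a x * u x + b x * w x) + 2 * max (w x) 0 * (d x * u x)
          ≤ K * φ x := by
        simp only [φ, K]
        generalize max (u x) 0 = p at *
        generalize max (w x) 0 = q at *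
        have e1 : a x * p ^ 2 ≤ A * p ^ 2 := mul_le_mul_of_nonneg_right hAx (sq_nonneg p)
        have e2 : b x * p * w x ≤ b x * p * q := mul_le_mul_of_nonneg_left hwle (by positivity)
        have e3 : d x * q * u x ≤ d x * q * p := mul_le_mul_of_nonneg_left hule (by positivity)
        have e4 : b x * (p * q) ≤ B * (p * q) := mul_le_mul_of_nonneg_right hBx (by positivity)
        have e5 : d x * (p * q) ≤ D * (p * q) := mul_le_mul_of_nonneg_right hDx (by positivity)
        have hB0 : 0 ≤ B := hbx.trans hBx
        have hD0 : 0 ≤ D := hdx.trans hDx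
        have hA0 : 0 ≤ A := (norm_nonneg _).trans (hA x hxI)
        have e6 : 0 ≤ (B + D) * (p - q) ^ 2 := by positivity
        have e7 : 0 ≤ A * q ^ 2 := by positivity
        linear_combination 2 * e1 + 2 * e2 + 2 * e3 + 2 * e4 + 2 * e5 + e6 + 2 * e7
          + 2 * a x * hpu
      have := mul_le_mul_of_nonneg_right key (exp_pos (-K * x)).le
      linarith
  have hle := hanti (left_mem_Icc.2 hst) (right_mem_Icc.2 hst) hst
  simp only [hφ0, zero_mul] at hle
  have hφt : φ t ≤ 0 := nonpos_of_mul_nonpos_left hle (exp_pos _)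
  simp only [φ] at hφt
  have hut : max (u t) 0 = 0 := by nlinarith [sq_nonneg (max (u t) 0), sq_nonneg (max (w t) 0)]
  have hwt : max (w t) 0 = 0 := by nlinarith [sq_nonneg (max (u t) 0), sq_nonneg (max (w t) 0)]
  exact ⟨max_eq_right_iff.1 hut, max_eq_right_iff.1 hwt⟩

/-- A scalar homogeneous linear equation preserves nonpositivity in forward time. -/
theorem nonpos_of_linear {s t : ℝ} (hst : s ≤ t) {u a : ℝ → ℝ}
    (hu : ContinuousOn u (Icc s t)) (ha : ContinuousOn a (Icc s t))
    (hu' : ∀ x ∈ Ioo s t, HasDerivAt u (a x * u x) x) (hus : u s ≤ 0) : u t ≤ 0 :=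
  (nonpos_of_cooperative (w := fun _ => 0) (b := fun _ => 0) (d := fun _ => 0) hst hu
    continuousOn_const ha continuousOn_const continuousOn_const
    (fun x hx => by simpa using hu' x hx) (fun x _ => by simpa using hasDerivAt_const x (0 : ℝ))
    (fun _ _ => le_rfl) (fun _ _ => le_rfl) hus le_rfl).1

/-- A scalar homogeneous linear equation preserves nonnegativity in forward time. -/
theorem nonneg_of_linear {s t : ℝ} (hst : s ≤ t) {u a : ℝ → ℝ}
    (hu : ContinuousOn u (Icc s t)) (ha : ContinuousOn a (Icc s t))
    (hu' : ∀ x ∈ Ioo s t, HasDerivAt u (a x * u x) x) (hus : 0 ≤ u s) : 0 ≤ u t := by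
  have := nonpos_of_linear (u := fun x => -u x) hst hu.neg ha
    (fun x hx => (hu' x hx).neg.congr_deriv (by ring)) (by simpa using hus)
  simpa using this

theorem continuous_G (m : ℕ) : Continuous (G m) := by
  unfold G; fun_prop

theorem continuous_Rs (m : ℕ) : Continuous (Rs m) := by
  unfold Rs R1 R2 R3; fun_prop

theorem continuous_L (m : ℕ) : Continuous (L m) := by
  unfold L
  exact (((continuous_G m).add (continuous_Rs m)).sub continuous_const).div_const _

theorem stmt3 (m : ℕ) (hm : 1 ≤ m) (I : Set ℝ) (hI : I.OrdConnected)
    (c : ℝ → Fin 6 → ℝ) (hc : IsSolution m I c)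
    (η₀ η₁ : ℝ) (hη₀ : η₀ ∈ I) (hη₁ : η₁ ∈ I) (hle : η₀ ≤ η₁)
    (h0 : c η₀ ∈ setE m ∩ setP ∩ setA1) :
    c η₁ ∈ setE m ∩ setP ∩ setA1 := by
  have hsub : Icc η₀ η₁ ⊆ I := hI.out hη₀ hη₁
  have hcont : ContinuousOn c (Icc η₀ η₁) := fun x hx =>
    ((hc x (hsub hx)).mono hsub).continuousWithinAt
  have hder : ∀ x ∈ Ioo η₀ η₁, ∀ i, HasDerivAt (fun y => c y i) (V m (c x) i) x := by
    intro x hx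
    exact hasDerivAt_pi.1 (((hc x (hsub (Ioo_subset_Icc_self hx))).mono hsub).hasDerivAt
      (Icc_mem_nhds hx.1 hx.2))
  have hcomp : ∀ {f : (Fin 6 → ℝ) → ℝ}, Continuous f →
      ContinuousOn (fun x => f (c x)) (Icc η₀ η₁) :=
    fun hf => hf.comp_continuousOn hcont
  have hG := continuous_G m
  have hR := continuous_Rs m
  have hL := continuous_L m
  have hLdef : ∀ p, G m p + Rs m p - 1 = (4 * (m : ℝ) + 2) * L m p := by
    intro p
    unfold L
    field_simp
  obtain ⟨⟨⟨hH, hQ⟩, hY1, hY2, hY3⟩, hX, hY⟩ := h0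
  have trace' : ∀ x ∈ Ioo η₀ η₁, HasDerivAt
      (fun y => c y 0 + 2 * c y 1 + 4 * (m : ℝ) * c y 2 - 1)
      ((G m (c x) + L m (c x) - 1) * (c x 0 + 2 * c x 1 + 4 * (m : ℝ) * c x 2 - 1)) x := by
    intro x hx
    refine ((((hder x hx 0).add ((hder x hx 1).const_mul 2)).add
      ((hder x hx 2).const_mul (4 * (m : ℝ)))).sub_const 1).congr_deriv ?_
    have h := hLdef (c x)
    simp only [Rs] at h
    simp [V]
    linear_combination h
  have trace_one : ∀ t ∈ Icc η₀ η₁, c t 0 + 2 * c t 1 + 4 * (m : ℝ) * c t 2 = 1 := by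
    intro t ht
    have hss : Icc η₀ t ⊆ Icc η₀ η₁ := Icc_subset_Icc_right ht.2
    have hso : Ioo η₀ t ⊆ Ioo η₀ η₁ := Ioo_subset_Ioo_right ht.2
    have hu := (hcomp (f := fun p => p 0 + 2 * p 1 + 4 * (m : ℝ) * p 2 - 1)
      (by fun_prop)).mono hss
    have ha := (hcomp (f := fun p => G m p + L m p - 1) (by fun_prop)).mono hss
    have h1 := nonpos_of_linear ht.1 hu ha (fun x hx => trace' x (hso hx)) (by linarith)
    have h2 := nonneg_of_linear ht.1 hu ha (fun x hx => trace' x (hso hx)) (by linarith)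
    linarith
  have scal' : ∀ x ∈ Ioo η₀ η₁, HasDerivAt (fun y => G m (c y) + Rs m (c y) - 1)
      (2 * (G m (c x) + L m (c x)) * (G m (c x) + Rs m (c x) - 1)) x := by
    intro x hx
    have h0 := hder x hx 0
    have h1 := hder x hx 1
    have h2 := hder x hx 2
    have q3 := (hder x hx 3).pow 2
    have q4 := (hder x hx 4).pow 2
    have h4 := hder x hx 4
    have h5 := hder x hx 5
    have q5 := h5.pow 2
    have hg := ((h0.pow 2).add ((h1.pow 2).const_mul 2)).add ((h2.pow 2).const_mul (4 * (m : ℝ)))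
    have hr1 := ((q3.const_mul (1 / 2)).mul q4).add ((q3.const_mul ((m : ℝ) / 4)).mul q5)
    have hr2 := ((q4.const_mul 2).sub ((q3.const_mul (1 / 2)).mul q4)).add
      (q5.const_mul ((m : ℝ) / 2))
    have hr3 := (((h4.const_mul ((m : ℝ) + 2)).mul h5).sub ((q3.const_mul (1 / 8)).mul q5)).sub
      (q5.const_mul (1 / 2))
    refine ((hg.add ((hr1.add (hr2.const_mul 2)).add (hr3.const_mul (4 * (m : ℝ))))).sub_const
      1).congr_deriv ?_
    have ht := trace_one x (Ioo_subset_Icc_self hx)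
    simp [V]
    generalize L m (c x) = l
    simp only [G, Rs, R1, R2, R3]
    linear_combination (-2 * l) * ht
  have hE := nonpos_of_linear hle (hcomp (f := fun p => G m p + Rs m p - 1) (by fun_prop))
    (hcomp (f := fun p => 2 * (G m p + L m p)) (by fun_prop)) scal' (by linarith)
  have hP1 := nonneg_of_linear hle (hcomp (f := fun p => p 3) (by fun_prop))
    (hcomp (f := fun p => p 0 - p 1) (by fun_prop))
    (fun x hx => (hder x hx 3).congr_deriv (by simp [V]; ring)) hY1
  have hP2 := nonneg_of_linear hle (hcomp (f := fun p => p 4) (by fun_prop))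
    (hcomp (f := fun p => G m p + L m p - p 1) (by fun_prop))
    (fun x hx => (hder x hx 4).congr_deriv (by simp [V]; ring)) hY2
  have hP3 := nonneg_of_linear hle (hcomp (f := fun p => p 5) (by fun_prop))
    (hcomp (f := fun p => G m p + L m p + p 1 - 2 * p 2) (by fun_prop))
    (fun x hx => (hder x hx 5).congr_deriv (by simp [V]; ring)) hY3
  have hA := nonpos_of_cooperative hle
    (hcomp (f := fun p => p 0 - p 1) (by fun_prop))
    (hcomp (f := fun p => p 3 ^ 2 - 2) (by fun_prop))
    (hcomp (f := fun p => G m p + L m p - 1) (by fun_prop))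
    (hcomp (f := fun p => p 4 ^ 2 + (m : ℝ) / 4 * p 5 ^ 2) (by fun_prop))
    (hcomp (f := fun p => 2 * p 3 ^ 2) (by fun_prop))
    (fun x hx => ((hder x hx 0).sub (hder x hx 1)).congr_deriv (by simp [V, R1, R2]; ring))
    (fun x hx => (((hder x hx 3).pow 2).sub_const 2).congr_deriv (by simp [V]; ring))
    (fun x _ => by positivity) (fun x _ => by positivity) (by linarith) (by linarith)
  exact ⟨⟨⟨trace_one η₁ (right_mem_Icc.2 hle), by linarith⟩, hP1, hP2, hP3⟩,
    by linarith [hA.1], by linarith [hA.2]⟩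

end
end

section
/- If a point p = (X₁, X₂, X₃, Y₁, Y₂, Y₃) belongs to 𝓢 and satisfies G(p) + L(p) = 0, then X₁ = X₂ = X₃ = 1/(4m+3), Y₂ = Y₃ = 0, and hence R_s(p) = 0 and G(p) = 1/(4m+3); that is, p lies on the line P_{AH} = {(1/(4m+3), 1/(4m+3), 1/(4m+3), y₁, 0, 0) : y₁ ∈ ℝ}. -/
open Real Set Filter

noncomputable section

/-- The weighted variance identity for the weights `1, 2, 4m` on the hyperplane of `setE`. -/
lemma G_variance (m : ℕ) (p : Fin 6 → ℝ) (hsum : p 0 + 2*p 1 + 4*(m:ℝ)*p 2 = 1) :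
    (4*(m:ℝ)+3) * G m p - 1 =
      2*(p 0 - p 1)^2 + 4*(m:ℝ)*(p 0 - p 2)^2 + 8*(m:ℝ)*(p 1 - p 2)^2 := by
  have hsq : (p 0 + 2*p 1 + 4*(m:ℝ)*p 2)^2 = 1 := by rw [hsum, one_pow]
  unfold G
  linear_combination hsq

/-- A lower bound for the scalar curvature `Rs` in the region `Y₁² ≤ 2`, `0 ≤ Y₃ ≤ 2 Y₂`. -/
lemma three_mul_sq_le_Rs (m : ℕ) (p : Fin 6 → ℝ) (h1 : (p 3)^2 ≤ 2) (h2 : 0 ≤ p 4)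
    (h3 : 0 ≤ p 5) (h32 : 0 ≤ 2*p 4 - p 5) : 3*(p 4)^2 ≤ Rs m p := by
  have hm0 : (0:ℝ) ≤ m := Nat.cast_nonneg m
  have e1 : 0 ≤ (2 - (p 3)^2) * ((1/2)*(p 4)^2 + (m:ℝ)/4*(p 5)^2) :=
    mul_nonneg (by linarith) (by positivity)
  have e2 : 0 ≤ (m:ℝ) * (p 5 * (2*p 4 - p 5)) := by positivity
  have e3 : 0 ≤ (4*(m:ℝ)^2 + 5*(m:ℝ)) * (p 4 * p 5) := by positivity
  unfold Rs R1 R2 R3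
  linarith

theorem stmt12 (m : ℕ) (hm : 1 ≤ m) (p : Fin 6 → ℝ) (hp : p ∈ setS m)
    (h : G m p + L m p = 0) :
    p 0 = 1/(4*(m:ℝ)+3) ∧ p 1 = 1/(4*(m:ℝ)+3) ∧ p 2 = 1/(4*(m:ℝ)+3) ∧
    p 4 = 0 ∧ p 5 = 0 ∧ Rs m p = 0 ∧ G m p = 1/(4*(m:ℝ)+3) := by
  obtain ⟨⟨⟨⟨hsum, -⟩, -, hY2, hY3⟩, -, hY1⟩, hY32, -⟩ := hp
  have hm1 : (1:ℝ) ≤ m := by exact_mod_cast hm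
  have hGR : (4*(m:ℝ)+3) * G m p + Rs m p = 1 := by
    unfold L at h
    field_simp at h
    linarith
  have hvar := G_variance m p hsum
  have hRs := three_mul_sq_le_Rs m p hY1 hY2 hY3 hY32
  have a0 : 0 ≤ (p 4)^2 := sq_nonneg _
  have a1 : 0 ≤ (p 0 - p 1)^2 := sq_nonneg _
  have a2 : 0 ≤ 4*(m:ℝ)*(p 0 - p 2)^2 := by positivity
  have a3 : 0 ≤ 8*(m:ℝ)*(p 1 - p 2)^2 := by positivity
  have h4 : p 4 = 0 := pow_eq_zero_iff two_ne_zero |>.1 (by linarith)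
  have h5 : p 5 = 0 := by linarith
  have h01 : p 0 - p 1 = 0 := pow_eq_zero_iff two_ne_zero |>.1 (by linarith)
  have h02 : p 0 - p 2 = 0 := by
    have : 4*(m:ℝ)*(p 0 - p 2)^2 = 0 := by linarith
    exact pow_eq_zero_iff two_ne_zero |>.1
      ((mul_eq_zero.1 this).resolve_left (by positivity))
  have hR0 : Rs m p = 0 := by linarith
  have e1 : p 1 = p 0 := by linarith
  have e2 : p 2 = p 0 := by linarith
  have hX : p 0 = 1/(4*(m:ℝ)+3) := by
    rw [e1, e2] at hsum
    rw [eq_div_iff (by positivity)]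
    linarith
  refine ⟨hX, e1.trans hX, e2.trans hX, h4, h5, hR0, ?_⟩
  rw [eq_div_iff (by positivity)]
  linarith

end
end
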